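/- arXiv:1107.3870 — 5 statements merged into one kernel-verified Lean document; each statement's English description precedes it below -/
import Mathlib

section
/- For every natural number n, the identity ∑_{i=0}^{n} C(n+i, 3i) · C(3i, i) / (2i+1) = C(2n, n) / (n+1) holds in the rational numbers, where C(a,b) denotes the binomial coefficient (note that the terms with 3i > n+i vanish). -/
open PowerSeries in
theorem coeff_expand_two_mul_one_add_X_pow (n : ℕ) :
    coeff n (expand 2 two_ne_zero ((mk 1 : ℚ⟦X⟧) ^ (n + 1)) * (1 + X) ^ (n + 1)) =
      ∑ i ∈ Finset.range (n + 1), ((n + i).choose n * (n + 1).choose (2 * i + 1) : ℚ) := by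
  rw [coeff_mul, Finset.Nat.sum_antidiagonal_eq_sum_range_succ_mk]
  have h_coeff : ∀ k, coeff k ((1 + X : ℚ⟦X⟧) ^ (n + 1)) = (n + 1).choose k := by
    intro k
    rw [← Polynomial.coeff_one_add_X_pow, ← Polynomial.coeff_coe]
    simp
  let g : ℕ → ℚ := fun k =>
    (if 2 ∣ k then ((n + k / 2).choose n : ℚ) else 0) * (n + 1).choose (k + 1)
  trans ∑ k ∈ Finset.range (n + 1), g k
  · refine Finset.sum_congr rfl fun k hk => ?_
    have hkn : k ≤ n := Finset.mem_range_succ_iff.mp hk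
    have h_symm : (n + 1).choose (n - k) = (n + 1).choose (k + 1) :=
      Nat.choose_symm_of_eq_add (by omega)
    simp only [g, h_coeff, h_symm, coeff_expand, mk_one_pow_eq_mk_choose_add, coeff_mk]
  trans ∑ k ∈ Finset.range (2 * n + 1), g k
  · refine Finset.sum_subset (by intro k; simp; omega) fun k _ hk => ?_
    have hkn : n + 1 < k + 1 := by simpa using hk
    simp [g, Nat.choose_eq_zero_of_lt hkn]
  · symm
    refine Finset.sum_of_injOn (2 * ·) ?_ ?_ ?_ ?_
    · intro a _ b _ h
      simpa using h
    · intro a ha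
      simp at ha ⊢
      omega
    · intro k hk h_image
      have h_odd : ¬ 2 ∣ k := by
        rintro ⟨i, rfl⟩
        simp at hk h_image
        omega
      simp [g, h_odd]
    · intro i _
      simp [g]

open PowerSeries in
theorem sum_choose_mul_choose_two_mul_add_one (n : ℕ) :
    ∑ i ∈ Finset.range (n + 1), ((n + i).choose n * (n + 1).choose (2 * i + 1) : ℚ) =
      (2 * n).choose n := by
  rw [← coeff_expand_two_mul_one_add_X_pow]
  have h_geom : expand 2 two_ne_zero (mk 1 : ℚ⟦X⟧) * (1 + X) = mk 1 := by
    have h_inv := mk_one_mul_one_sub_eq_one ℚ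
    have h_expand := congrArg (expand 2 two_ne_zero) h_inv
    simp only [map_mul, map_sub, map_one, expand_X] at h_expand
    linear_combination (mk 1 : ℚ⟦X⟧) * h_expand -
      expand 2 two_ne_zero (mk 1 : ℚ⟦X⟧) * (1 + X) * h_inv
  rw [map_pow, ← mul_pow, h_geom, mk_one_pow_eq_mk_choose_add, coeff_mk, two_mul]

theorem choose_three_mul_mul_choose_div (n i : ℕ) :
    ((n + i).choose (3 * i) * (3 * i).choose i : ℚ) / (2 * i + 1) =
      ((n + i).choose n * (n + 1).choose (2 * i + 1) : ℚ) / (n + 1) := by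
  rcases lt_or_ge n (2 * i) with h | h
  · rw [Nat.choose_eq_zero_of_lt (by omega : n + i < 3 * i),
      Nat.choose_eq_zero_of_lt (by omega : n + 1 < 2 * i + 1)]
    simp
  · obtain ⟨m, rfl⟩ := Nat.exists_eq_add_of_le h
    rw [Nat.cast_choose ℚ (by omega : 3 * i ≤ 2 * i + m + i),
      Nat.cast_choose ℚ (by omega : i ≤ 3 * i),
      Nat.cast_choose ℚ (by omega : 2 * i + m ≤ 2 * i + m + i),
      Nat.cast_choose ℚ (by omega : 2 * i + 1 ≤ 2 * i + m + 1),
      show 2 * i + m + i - 3 * i = m by omega, show 3 * i - i = 2 * i by omega,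
      show 2 * i + m + i - (2 * i + m) = i by omega,
      show 2 * i + m + 1 - (2 * i + 1) = m by omega,
      Nat.factorial_succ (2 * i), Nat.factorial_succ (2 * i + m)]
    have h_fact : ∀ k : ℕ, (k.factorial : ℚ) ≠ 0 := fun k => by
      exact_mod_cast k.factorial_ne_zero
    have := h_fact m
    have := h_fact i
    have := h_fact (2 * i)
    have := h_fact (3 * i)
    have := h_fact (2 * i + m)
    push_cast
    field_simp

/-- For every natural number `n`,
`∑_{i=0}^{n} C(n+i, 3i) · C(3i, i) / (2i+1) = C(2n, n) / (n+1)` in `ℚ`. -/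
theorem stmt_0 (n : ℕ) :
    ∑ i ∈ Finset.range (n + 1),
      ((n + i).choose (3 * i) * (3 * i).choose i : ℚ) / (2 * i + 1) =
      ((2 * n).choose n : ℚ) / (n + 1) := by
  simp_rw [choose_three_mul_mul_choose_div, ← Finset.sum_div,
    sum_choose_mul_choose_two_mul_add_one]
end

section
/- Let D : ℤ × ℤ → ℤ be a function such that: (i) for all natural numbers m, n with n ≤ 2m, D(m,n) equals the number of lattice paths from (0,0) to (m,n) with unit up steps (0,1) and unit right steps (1,0) in which every point (a,b) on the path satisfies b ≤ 2a; and (ii) for all integers m, n with n ≥ 1, m + n ≥ 1, and n > 2(m−1), D(m−1, n) = D(m, n) − D(m, n−1). Then for every natural number n, D(−n−1, n+1) = (−1)^{n+1} · C_n, where C_n is the n-th Catalan number. -/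
/-- The number of entries of value `b` among the first `k` entries of `s`. -/
def countUpto {L : ℕ} (s : Fin L → Bool) (k : ℕ) (b : Bool) : ℕ :=
  (Finset.univ.filter fun i : Fin L => i.val < k ∧ s i = b).card

/-- The number of monotone lattice paths starting at `(a, b)`, consisting of `r` unit right
steps `(1,0)` and `u` unit up steps `(0,1)` in some order (hence ending at `(a + r, b + u)`),
such that every point `(x, y)` visited by the path satisfies `ok x y`.  A path is encoded by
the sequence of its steps: `s i = true` means the `i`-th step is a right step and
`s i = false` means it is an up step. -/
def monoPathCount (a b : ℤ) (r u : ℕ) (ok : ℤ → ℤ → Prop)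
    [∀ x y, Decidable (ok x y)] : ℕ :=
  (Finset.univ.filter fun s : Fin (r + u) → Bool =>
    countUpto s (r + u) true = r ∧
    ∀ k, k ≤ r + u →
      ok (a + (countUpto s k true : ℤ)) (b + (countUpto s k false : ℤ))).card

theorem countUpto_true_add_false {L : ℕ} (s : Fin L → Bool) :
    countUpto s L true + countUpto s L false = L := by
  have h := Finset.card_filter_add_card_filter_not (s := (Finset.univ : Finset (Fin L)))
    (fun i => s i = true)
  simpa [countUpto] using h

theorem countUpto_snoc_of_le {L : ℕ} (s : Fin L → Bool) (b c : Bool) {k : ℕ} (hk : k ≤ L) :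
    countUpto (Fin.snoc s b : Fin (L + 1) → Bool) k c = countUpto s k c := by
  simp only [countUpto, Finset.card_filter]
  rw [Fin.sum_univ_castSucc]
  simp [hk.not_gt]

theorem countUpto_snoc_succ {L : ℕ} (s : Fin L → Bool) (b c : Bool) :
    countUpto (Fin.snoc s b : Fin (L + 1) → Bool) (L + 1) c
      = countUpto s L c + if b = c then 1 else 0 := by
  simp only [countUpto, Finset.card_filter]
  rw [Fin.sum_univ_castSucc]
  congr 1
  · refine Finset.sum_congr rfl fun i _ => ?_
    simp [i.isLt, i.isLt.trans (Nat.lt_succ_self L)]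
  · simp

/-- The number of sequences of `L` steps, `r` of which are right steps, all of whose prefixes
stay weakly below the line `y = 2x`. -/
def stepCount (L r : ℕ) : ℕ :=
  (Finset.univ.filter fun s : Fin L → Bool =>
    countUpto s L true = r ∧
    ∀ k, k ≤ L → countUpto s k false ≤ 2 * countUpto s k true).card

theorem monoPathCount_eq_stepCount (m n : ℕ) :
    monoPathCount 0 0 m n (fun x y => y ≤ 2 * x) = stepCount (m + n) m := by
  unfold monoPathCount stepCount
  congr 1
  refine Finset.filter_congr fun s _ => ?_
  refine and_congr_right fun _ => forall₂_congr fun k _ => ?_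
  simp only [zero_add]
  norm_cast

theorem stepCount_eq_zero {L r : ℕ} (h : 3 * r < L) : stepCount L r = 0 := by
  refine Finset.card_eq_zero.2 (Finset.filter_eq_empty_iff.2 ?_)
  rintro s - ⟨h1, h2⟩
  have := h2 L le_rfl
  have := countUpto_true_add_false s
  omega

theorem stepCount_eq_zero_of_lt {L r : ℕ} (h : L < r) : stepCount L r = 0 := by
  refine Finset.card_eq_zero.2 (Finset.filter_eq_empty_iff.2 ?_)
  rintro s - ⟨h1, h2⟩
  have := countUpto_true_add_false s
  omega

theorem stepCount_succ_succ {L r : ℕ} (h : L ≤ 3 * r + 2) :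
    stepCount (L + 1) (r + 1) = stepCount L r + stepCount L (r + 1) := by
  unfold stepCount
  simp only [Finset.card_filter]
  rw [← Equiv.sum_comp (Fin.snocEquiv fun _ : Fin (L + 1) => Bool), Fintype.sum_prod_type]
  simp only [Fintype.sum_bool]
  congr 1 <;>
  · refine Finset.sum_congr rfl fun s _ => ?_
    refine if_congr ?_ rfl rfl
    simp only [Nat.le_add_one_iff, or_comm (a := _ ≤ L)]
    have key : ∀ b, countUpto (Fin.snoc s b : Fin (L + 1) → Bool) (L + 1) true = r + 1 →
      ((∀ k, k = L + 1 ∨ k ≤ L → countUpto (Fin.snoc s b : Fin (L + 1) → Bool) k false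
        ≤ 2 * countUpto (Fin.snoc s b : Fin (L + 1) → Bool) k true) ↔
        ∀ k, k ≤ L → countUpto s k false ≤ 2 * countUpto s k true) := by
      intro b hb
      constructor
      · intro H k hk
        have := H k (Or.inr hk)
        rwa [countUpto_snoc_of_le _ _ _ hk, countUpto_snoc_of_le _ _ _ hk] at this
      · rintro H k (rfl | hk)
        · have := countUpto_true_add_false (Fin.snoc s b : Fin (L + 1) → Bool)
          omega
        · rw [countUpto_snoc_of_le _ _ _ hk, countUpto_snoc_of_le _ _ _ hk]
          exact H k hk
    refine (and_congr_right (key _)).trans ?_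
    rw [countUpto_snoc_succ]
    simp

theorem stepCount_self (L : ℕ) : stepCount L L = 1 := by
  induction L with
  | zero => decide
  | succ L ih => rw [stepCount_succ_succ (by omega), ih, stepCount_eq_zero_of_lt (by omega)]

open PowerSeries in
/-- The coefficient of `Xⁿ` in `(1 - X)(1 + 2X)(1 + X + X²)ⁱ(1 + X)⁻⁽ⁿ⁺¹⁾`. -/
noncomputable def kernelCoeff (i n : ℕ) : ℤ :=
  coeff n ((1 + X - 2 * X ^ 2 : ℤ⟦X⟧) * (1 + X + X ^ 2) ^ i * binomialSeries ℤ (-(n + 1) : ℤ))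

open PowerSeries in
theorem kernelCoeff_zero_right (i : ℕ) : kernelCoeff i 0 = 1 := by
  simp [kernelCoeff]

open PowerSeries in
theorem one_add_X_mul_binomialSeries (r : ℤ) :
    (1 + X : ℤ⟦X⟧) * binomialSeries ℤ r = binomialSeries ℤ (r + 1) := by
  have h : binomialSeries ℤ (1 : ℤ) = (1 + X : ℤ⟦X⟧) := by
    simpa using binomialSeries_nat (R := ℤ) (A := ℤ) 1
  rw [binomialSeries_add, h, mul_comm]

open PowerSeries in
theorem kernelCoeff_succ_succ (i n : ℕ) :
    kernelCoeff (i + 1) (n + 1) = kernelCoeff i (n + 1) + kernelCoeff i n := by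
  simp only [kernelCoeff]
  have h : binomialSeries ℤ (-(n + 1) : ℤ)
      = (1 + X : ℤ⟦X⟧) * binomialSeries ℤ (-((n + 1 : ℕ) + 1) : ℤ) := by
    rw [one_add_X_mul_binomialSeries]; congr 1
  rw [h, ← coeff_succ_X_mul n, ← map_add]
  congr 1
  ring

open PowerSeries in
theorem kernelCoeff_eq_sum (i n : ℕ) :
    kernelCoeff i n = ∑ j ∈ Finset.range (i + 1), (i.choose j : ℤ) *
      ((if 2 * j ≤ n then Ring.choose (i - j - n : ℤ) (n - 2 * j) else 0) -
        2 * if 2 * j + 2 ≤ n then Ring.choose (i - j - n - 1 : ℤ) (n - (2 * j + 2)) else 0) := by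
  have h : (1 + X - 2 * X ^ 2 : ℤ⟦X⟧) * (1 + X + X ^ 2) ^ i * binomialSeries ℤ (-(n + 1) : ℤ)
      = ∑ j ∈ Finset.range (i + 1), C (i.choose j : ℤ) *
        (X ^ (2 * j) * binomialSeries ℤ (i - j - n : ℤ) -
          C 2 * (X ^ (2 * j + 2) * binomialSeries ℤ (i - j - n - 1 : ℤ))) := by
    rw [add_comm (1 + X) (X ^ 2), add_pow, Finset.mul_sum, Finset.sum_mul]
    refine Finset.sum_congr rfl fun j hj => ?_
    have hj : j ≤ i := Nat.lt_succ_iff.1 (Finset.mem_range.1 hj)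
    have h1 : binomialSeries ℤ (i - j - n : ℤ)
        = (1 + X : ℤ⟦X⟧) * binomialSeries ℤ (i - j - n - 1 : ℤ) := by
      rw [one_add_X_mul_binomialSeries]; congr 1; ring
    have h2 : binomialSeries ℤ (i - j - n - 1 : ℤ)
        = (1 + X : ℤ⟦X⟧) ^ (i - j) * binomialSeries ℤ (-(n + 1) : ℤ) := by
      rw [← binomialSeries_nat (R := ℤ), ← binomialSeries_add]
      congr 1; push_cast [hj]; ring
    rw [h1, h2]
    simp only [map_natCast, map_ofNat]
    ring
  rw [kernelCoeff, h, map_sum]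
  refine Finset.sum_congr rfl fun j _ => ?_
  rw [coeff_C_mul, map_sub, coeff_C_mul, coeff_X_pow_mul', coeff_X_pow_mul']
  simp

theorem Int.ringChoose_eq_zero {r : ℤ} {k : ℕ} (h0 : 0 ≤ r) (h : r < k) : Ring.choose r k = 0 := by
  lift r to ℕ using h0
  rw [Ring.choose_natCast, Nat.choose_eq_zero_of_lt (by exact_mod_cast h), Nat.cast_zero]

theorem kernelCoeff_odd (k : ℕ) : kernelCoeff (3 * k + 1) (2 * k + 1) = 0 := by
  rw [kernelCoeff_eq_sum]
  refine Finset.sum_eq_zero fun j _ => ?_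
  have h1 : (if 2 * j ≤ 2 * k + 1 then
      Ring.choose ((3 * k + 1 : ℕ) - j - (2 * k + 1 : ℕ) : ℤ) (2 * k + 1 - 2 * j) else 0) = 0 :=
    ite_eq_right_iff.2 fun h => Int.ringChoose_eq_zero (by omega) (by omega)
  have h2 : (if 2 * j + 2 ≤ 2 * k + 1 then
      Ring.choose ((3 * k + 1 : ℕ) - j - (2 * k + 1 : ℕ) - 1 : ℤ) (2 * k + 1 - (2 * j + 2))
        else 0) = 0 :=
    ite_eq_right_iff.2 fun h => Int.ringChoose_eq_zero (by omega) (by omega)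
  rw [h1, h2]
  simp

theorem kernelCoeff_even (k : ℕ) : kernelCoeff (3 * k + 2) (2 * k + 2) = 0 := by
  rw [kernelCoeff_eq_sum]
  have key : ∀ j : ℕ,
      ((if 2 * j ≤ 2 * k + 2 then
        Ring.choose ((3 * k + 2 : ℕ) - j - (2 * k + 2 : ℕ) : ℤ) (2 * k + 2 - 2 * j) else 0) -
      2 * if 2 * j + 2 ≤ 2 * k + 2 then
        Ring.choose ((3 * k + 2 : ℕ) - j - (2 * k + 2 : ℕ) - 1 : ℤ) (2 * k + 2 - (2 * j + 2))
          else 0) = (if j = k + 1 then 1 else 0) - 2 * if j = k then 1 else 0 := by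
    intro j
    congr 1
    · split_ifs with h h' h'
      · subst h'
        rw [show 2 * k + 2 - 2 * (k + 1) = 0 by omega, Ring.choose_zero_right]
      · exact Int.ringChoose_eq_zero (by omega) (by omega)
      · omega
      · rfl
    · congr 1
      split_ifs with h h' h'
      · subst h'
        rw [Nat.sub_self, Ring.choose_zero_right]
      · exact Int.ringChoose_eq_zero (by omega) (by omega)
      · omega
      · rfl
  simp only [key]
  simp only [mul_sub, Finset.sum_sub_distrib, mul_ite, mul_one, mul_zero,
    Finset.sum_ite_eq', Finset.mem_range]
  rw [if_pos (by omega), if_pos (by omega)]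
  have h := Nat.choose_succ_right_eq (3 * k + 2) k
  rw [show 3 * k + 2 - k = 2 * (k + 1) by omega, ← mul_assoc] at h
  have h' := Nat.eq_of_mul_eq_mul_right (Nat.succ_pos k) h
  rw [h']
  push_cast
  ring

theorem Int.ringChoose_neg (a k : ℕ) :
    Ring.choose (-(a + 1) : ℤ) k = (-1) ^ k * ((a + k).choose k : ℤ) := by
  rw [Ring.choose_neg, show (a + 1 + k - 1 : ℤ) = ((a + k : ℕ) : ℤ) by push_cast; ring,
    Ring.choose_natCast, Units.smul_def, Int.coe_negOnePow_natCast, smul_eq_mul]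

theorem catalan_add_choose_succ (n : ℕ) :
    catalan n + (2 * n).choose (n + 1) = (2 * n).choose n := by
  have h1 := succ_mul_catalan_eq_centralBinom n
  have h2 := Nat.choose_succ_right_eq (2 * n) n
  rw [Nat.centralBinom_eq_two_mul_choose] at h1
  rw [show 2 * n - n = n by omega] at h2
  refine Nat.eq_of_mul_eq_mul_right (Nat.succ_pos n) ?_
  simp only [Nat.succ_eq_add_one]
  linarith

theorem kernelCoeff_zero_left_succ (n : ℕ) :
    kernelCoeff 0 (n + 1) = (-1) ^ (n + 1) * (catalan n : ℤ) := by
  rw [kernelCoeff_eq_sum]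
  cases n with
  | zero =>
    have := Int.ringChoose_neg 0 1
    simp_all
  | succ n =>
    have h1 := Int.ringChoose_neg (n + 1) (n + 2)
    have h2 := Int.ringChoose_neg (n + 2) n
    have h3 := catalan_add_choose_succ (n + 1)
    have h4 := Nat.choose_succ_succ (2 * (n + 1)) (n + 1)
    have h5 : (2 * (n + 1)).choose n = (2 * (n + 1)).choose (n + 1 + 1) :=
      Nat.choose_symm_of_eq_add (by ring)
    rw [show n + 1 + (n + 2) = (2 * (n + 1)).succ by omega] at h1
    rw [show n + 2 + n = 2 * (n + 1) by omega, h5] at h2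
    simp only [Nat.succ_eq_add_one] at *
    have h7 : -((n + 1 + 1 : ℕ) : ℤ) - 1 = -((n + 2 : ℕ) + 1) := by push_cast; ring
    have h8 : -((n + 1 + 1 : ℕ) : ℤ) = -((n + 1 : ℕ) + 1) := by push_cast; ring
    rw [Finset.sum_range_one]
    simp only [Nat.cast_zero, sub_zero, zero_sub, mul_zero, Nat.zero_le, if_true, zero_add]
    rw [if_pos (by omega), h7, h8, show n + 1 + 1 - 2 = n by omega,
      show n + 1 + 1 - 0 = n + 2 by omega, h1, h2, h4, ← h3]
    push_cast
    simp
    ring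

/-- If `D : ℤ × ℤ → ℤ` agrees with the number of lattice paths from `(0,0)` to `(m,n)`
staying weakly below the line `y = 2x` whenever `0 ≤ n ≤ 2m`, and satisfies the recurrence
`D(m-1,n) = D(m,n) - D(m,n-1)` whenever `n ≥ 1`, `m + n ≥ 1` and `n > 2(m-1)`, then
`D(-n-1, n+1) = (-1)^{n+1} Cₙ` where `Cₙ` is the `n`-th Catalan number. -/
theorem stmt_1 (D : ℤ × ℤ → ℤ)
    (hpath : ∀ m n : ℕ, n ≤ 2 * m →
      D ((m : ℤ), (n : ℤ)) = (monoPathCount 0 0 m n (fun x y => y ≤ 2 * x) : ℤ))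
    (hrec : ∀ m n : ℤ, 1 ≤ n → 1 ≤ m + n → 2 * (m - 1) < n →
      D (m - 1, n) = D (m, n) - D (m, n - 1)) :
    ∀ n : ℕ, D (-(n : ℤ) - 1, (n : ℤ) + 1) = (-1) ^ (n + 1) * (catalan n : ℤ) := by
  have hstep : ∀ m n : ℕ, n ≤ 2 * m → D ((m : ℤ), (n : ℤ)) = (stepCount (m + n) m : ℤ) :=
    fun m n h => by rw [hpath m n h, monoPathCount_eq_stepCount]
  -- The recurrence holds on the whole half-plane `0 ≤ m + n`.
  have hpascal : ∀ i n : ℕ, D ((i + 1 : ℤ) - (n + 1), (n + 1 : ℤ))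
      = D ((i : ℤ) - (n + 1), (n + 1 : ℤ)) + D ((i : ℤ) - n, (n : ℤ)) := by
    intro i n
    by_cases h : 2 * ((i : ℤ) - (n + 1)) < n + 1
    · have := hrec ((i : ℤ) - n) (n + 1) (by omega) (by omega) (by omega)
      rw [show (i : ℤ) - n - 1 = i - (n + 1) by ring, add_sub_cancel_right] at this
      rw [this, show (i + 1 : ℤ) - (n + 1) = i - n by ring]
      ring
    · obtain ⟨m, rfl⟩ : ∃ m : ℕ, i = m + (n + 1) := ⟨i - (n + 1), by omega⟩
      have h1 := hstep (m + 1) (n + 1) (by omega)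
      have h2 := hstep m (n + 1) (by omega)
      have h3 := hstep (m + 1) n (by omega)
      rw [show m + 1 + (n + 1) = (m + (n + 1)) + 1 by ring,
        stepCount_succ_succ (by omega)] at h1
      rw [show m + 1 + n = m + (n + 1) by ring] at h3
      push_cast at h1 h2 h3 ⊢
      rw [show (m + (n + 1) + 1 - (n + 1) : ℤ) = m + 1 by ring,
        show (m + (n + 1) - (n + 1) : ℤ) = m by ring,
        show (m + (n + 1) - n : ℤ) = m + 1 by ring]
      linarith
  have hodd : ∀ k : ℕ, D ((k : ℤ), 2 * (k : ℤ) + 1) = 0 := by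
    intro k
    have h0 := hrec (k + 1) (2 * k + 1) (by omega) (by omega) (by omega)
    have h1 := hstep (k + 1) (2 * k + 1) (by omega)
    have h2 := hstep (k + 1) (2 * k) (by omega)
    rw [show k + 1 + (2 * k + 1) = (3 * k + 1) + 1 by ring, stepCount_succ_succ (by omega),
      stepCount_eq_zero (by omega), zero_add] at h1
    rw [show k + 1 + 2 * k = 3 * k + 1 by ring] at h2
    push_cast at h1 h2
    rw [h1, add_sub_cancel_right, add_sub_cancel_right, h2, sub_self] at h0
    exact h0
  have heven : ∀ k : ℕ, D ((k : ℤ), 2 * (k : ℤ) + 2) = 0 := by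
    intro k
    have h0 := hrec (k + 1) (2 * k + 2) (by omega) (by omega) (by omega)
    have h1 := hstep (k + 1) (2 * k + 2) (by omega)
    have h2 := hstep (k + 1) (2 * k + 1) (by omega)
    rw [show k + 1 + (2 * k + 2) = (3 * k + 2) + 1 by ring, stepCount_succ_succ (by omega),
      stepCount_eq_zero (by omega), zero_add] at h1
    rw [show k + 1 + (2 * k + 1) = 3 * k + 2 by ring] at h2
    push_cast at h1 h2
    rw [h1, add_sub_cancel_right, show (2 * k + 2 - 1 : ℤ) = 2 * k + 1 by ring, h2,
      sub_self] at h0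
    exact h0
  have hD : ∀ n i : ℕ, D ((i : ℤ) - n, (n : ℤ)) = kernelCoeff i n := by
    intro n
    induction n with
    | zero =>
      intro i
      have h := hstep i 0 (by omega)
      rw [add_zero, stepCount_self] at h
      rw [kernelCoeff_zero_right]
      simpa using h
    | succ n ih =>
      have hshift : ∀ i : ℕ,
          D ((i + 1 : ℤ) - (n + 1), (n + 1 : ℤ)) - kernelCoeff (i + 1) (n + 1)
            = D ((i : ℤ) - (n + 1), (n + 1 : ℤ)) - kernelCoeff i (n + 1) := by
        intro i
        rw [hpascal, kernelCoeff_succ_succ, ih]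
        ring
      have hconst : ∀ i : ℕ, D ((i : ℤ) - (n + 1), (n + 1 : ℤ)) - kernelCoeff i (n + 1)
          = D (((0 : ℕ) : ℤ) - (n + 1), (n + 1 : ℤ)) - kernelCoeff 0 (n + 1) := by
        intro i
        induction i with
        | zero => rfl
        | succ i hi => rw [← hi, ← hshift i]; push_cast; rfl
      have hzero : ∃ i : ℕ, D ((i : ℤ) - (n + 1), (n + 1 : ℤ)) - kernelCoeff i (n + 1) = 0 := by
        obtain ⟨k, rfl | rfl⟩ := Nat.even_or_odd' n
        · refine ⟨3 * k + 1, ?_⟩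
          rw [kernelCoeff_odd, sub_zero, ← hodd k]
          congr 2; grind
        · refine ⟨3 * k + 2, ?_⟩
          rw [kernelCoeff_even, sub_zero, ← heven k]
          congr 2; grind
      obtain ⟨i₀, hi₀⟩ := hzero
      intro i
      push_cast
      linarith [hconst i, hconst i₀]
  intro n
  rw [← kernelCoeff_zero_left_succ, ← hD]
  congr 2; grind
end

section
/- For all natural numbers m and n, the number of generalized Dyck paths from (0,0) to (2m+n, n) that contain no four consecutive up steps and end with a down step (where for m = n = 0 the empty path is counted, giving the value 1) equals the number of sequences (s_1,…,s_m) ∈ {−1,0,1,2}^m such that every partial sum s_1 + ⋯ + s_k (0 ≤ k ≤ m) is nonnegative and s_1 + ⋯ + s_m = n. -/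
/-- The `k`-th entry of `s`, with default value `false` out of range. -/
def entry {L : ℕ} (s : Fin L → Bool) (k : ℕ) : Bool :=
  if h : k < L then s ⟨k, h⟩ else false

/-- The number of generalized Dyck paths from `(0,0)` to `(L, e)` (paths with up steps
`(1,1)` and down steps `(1,-1)` that never go below the `x`-axis) which contain no four
consecutive up steps and end with a down step (the empty path, for `L = 0`, counts).
A path is encoded by its sequence of steps: `s i = true` means the `i`-th step is an
up step, `s i = false` that it is a down step; the height after `k` steps is
`2 · #{ups among first k} - k`. -/
def gdpCount (L : ℕ) (e : ℤ) : ℕ :=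
  (Finset.univ.filter fun s : Fin L → Bool =>
    (∀ k : Fin (L + 1), (0 : ℤ) ≤ 2 * (countUpto s k.val true : ℤ) - (k.val : ℤ)) ∧
    2 * (countUpto s L true : ℤ) - (L : ℤ) = e ∧
    (∀ i : Fin L, ¬(entry s i.val = true ∧ entry s (i.val + 1) = true ∧
      entry s (i.val + 2) = true ∧ entry s (i.val + 3) = true)) ∧
    entry s (L - 1) = false).card

/-- The number of ways to continue for `L` more steps a path that has reached height `h` and
ends with exactly `r` up steps, so that the whole path ends at height `e`, never goes below `0`,
has no four consecutive up steps, and ends with a down step (or is empty). -/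
def continuationCount : ℕ → ℤ → ℕ → ℤ → ℕ
  | 0, h, r, e => if h = e ∧ r = 0 then 1 else 0
  | L + 1, h, r, e =>
    (if r < 3 then continuationCount L (h + 1) (r + 1) e else 0) +
      (if 1 ≤ h then continuationCount L (h - 1) 0 e else 0)

/-- The number of walks of `m` steps in `{-1, 0, 1, 2}` from `h` to `e` that stay nonnegative
after every step. -/
def walkCount : ℕ → ℤ → ℤ → ℕ
  | 0, h, e => if h = e then 1 else 0
  | m + 1, h, e =>
    ∑ x ∈ ({-1, 0, 1, 2} : Finset ℤ), if 0 ≤ h + x then walkCount m (h + x) e else 0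

theorem continuationCount_succ (L : ℕ) (h : ℤ) (r : ℕ) (e : ℤ) :
    continuationCount (L + 1) h r e =
      (if r < 3 then continuationCount L (h + 1) (r + 1) e else 0) +
        (if 1 ≤ h then continuationCount L (h - 1) 0 e else 0) := rfl

theorem walkCount_eq_zero {m : ℕ} {h e : ℤ} (hlt : e + m < h) : walkCount m h e = 0 := by
  induction m generalizing h with
  | zero => simp [walkCount]; push_cast at hlt; omega
  | succ m ih =>
    refine Finset.sum_eq_zero fun x hx => ?_
    have hx' : -1 ≤ x := by
      simp only [Finset.mem_insert, Finset.mem_singleton] at hx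
      omega
    rw [ih (by push_cast at hlt; omega), ite_self]

theorem continuationCount_eq_zero {L : ℕ} {h : ℤ} {r : ℕ} {e : ℤ} (hle : h + L ≤ e)
    (hne : h + L ≠ e ∨ r ≠ 0 ∨ L ≠ 0) : continuationCount L h r e = 0 := by
  induction L generalizing h r with
  | zero =>
    simp only [continuationCount]
    rw [if_neg]
    push_cast at *
    omega
  | succ L ih =>
    push_cast at hle
    rw [continuationCount, ih (by omega) (by omega), ih (by omega) (by omega)]
    simp

theorem continuationCount_eq_walkCount {m L : ℕ} {h e : ℤ} (hh : 0 ≤ h)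
    (hL : (L : ℤ) = 2 * m + e - h) : continuationCount L h 0 e = walkCount m h e := by
  induction m generalizing L h with
  | zero =>
    push_cast at hL
    by_cases hL0 : L = 0
    · subst hL0
      simp [continuationCount, walkCount]
    · rw [continuationCount_eq_zero (by omega) (by omega), walkCount, if_neg (by omega)]
  | succ m ih =>
    push_cast at hL
    have key : ∀ (K : ℕ) (x : ℤ), (K : ℤ) = 2 * m + e - (h + x) → 0 ≤ h + x →
        continuationCount K (h + x) 0 e = walkCount m (h + x) e :=
      fun K x hK hx => ih hx hK
    have vanish : ∀ x : ℤ, 2 * m + e < h + x → walkCount m (h + x) e = 0 :=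
      fun x hx => walkCount_eq_zero (by omega)
    have expand : walkCount (m + 1) h e = (if 0 ≤ h - 1 then walkCount m (h + -1) e else 0) +
        walkCount m (h + 0) e + walkCount m (h + 1) e + walkCount m (h + 2) e := by
      rw [walkCount, Finset.sum_insert (by decide), Finset.sum_insert (by decide),
        Finset.sum_insert (by decide), Finset.sum_singleton, if_pos (by omega : 0 ≤ h + 0),
        if_pos (by omega : 0 ≤ h + 1), if_pos (by omega : 0 ≤ h + 2), ← sub_eq_add_neg]
      ring
    rw [expand]
    have e1 : h + 1 - 1 = h + 0 := by ring
    have e2 : h + 1 + 1 - 1 = h + 1 := by ring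
    have e3 : h + 1 + 1 + 1 - 1 = h + 2 := by ring
    have e4 : h - 1 = h + -1 := by ring
    have p1 : 1 ≤ h + 1 := by omega
    have p2 : 1 ≤ h + 1 + 1 := by omega
    have p3 : 1 ≤ h + 1 + 1 + 1 := by omega
    have ev : (if 1 ≤ h then walkCount m (h + -1) e else 0) =
        if 0 ≤ h - 1 then walkCount m (h + -1) e else 0 := by
      congr 1; exact propext ⟨fun _ => by omega, fun _ => by omega⟩
    rw [← ev]
    have first : ∀ K : ℕ, (K : ℤ) = 2 * m + e - (h + -1) →
        (if 1 ≤ h then continuationCount K (h + -1) 0 e else 0) =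
          if 1 ≤ h then walkCount m (h + -1) e else 0 := by
      intro K hK
      split_ifs with h1
      · exact key K _ hK (by omega)
      · rfl
    match L, hL with
    | 0, hL =>
      rw [vanish (-1) (by push_cast at hL; omega), vanish 0 (by push_cast at hL; omega),
        vanish 1 (by push_cast at hL; omega), vanish 2 (by push_cast at hL; omega)]
      simp only [continuationCount]
      rw [if_neg (by push_cast at hL; omega)]
      simp
    | 1, hL =>
      push_cast at hL
      rw [vanish 0 (by omega), vanish 1 (by omega), vanish 2 (by omega),
        ← first 0 (by push_cast; omega)]
      simp [continuationCount, e4]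
    | 2, hL =>
      push_cast at hL
      rw [vanish 1 (by omega), vanish 2 (by omega),
        ← first 1 (by push_cast; omega), ← key 0 0 (by push_cast; omega) (by omega)]
      simp [e1, e4, p1, continuationCount, -add_zero]
      ring
    | 3, hL =>
      push_cast at hL
      rw [vanish 2 (by omega),
        ← first 2 (by push_cast; omega), ← key 1 0 (by push_cast; omega) (by omega),
        ← key 0 1 (by push_cast; omega) (by omega)]
      simp [e1, e2, e4, p1, p2, continuationCount, -add_zero]
      ring
    | K + 4, hL =>
      push_cast at hL
      rw [← first (K + 3) (by push_cast; omega), ← key (K + 2) 0 (by push_cast; omega) (by omega),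
        ← key (K + 1) 1 (by push_cast; omega) (by omega),
        ← key K 2 (by omega) (by omega)]
      rw [continuationCount_succ (K + 3), continuationCount_succ (K + 2) (h + 1),
        continuationCount_succ (K + 1) (h + 1 + 1), continuationCount_succ K (h + 1 + 1 + 1)]
      simp [e1, e2, e3, e4, p1, p2, p3, -add_zero]
      ring

theorem Fin.sum_pi_succ_eq_sum_cons {L : ℕ} {α M : Type*} [Fintype α] [DecidableEq α]
    [AddCommMonoid M] (F : (Fin (L + 1) → α) → M) :
    ∑ f, F f = ∑ a, ∑ s : Fin L → α, F (Fin.cons a s) := by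
  rw [← Fintype.sum_prod_type']
  exact (Fintype.sum_equiv (Fin.consEquiv fun _ => α) _ _ fun _ => rfl).symm

theorem entry_cons_zero {L : ℕ} (b : Bool) (s : Fin L → Bool) :
    entry (Fin.cons b s : Fin (L + 1) → Bool) 0 = b := by
  simp [entry]

theorem entry_cons_succ {L : ℕ} (b : Bool) (s : Fin L → Bool) (k : ℕ) :
    entry (Fin.cons b s : Fin (L + 1) → Bool) (k + 1) = entry s k := by
  by_cases hk : k < L
  · have : (⟨k + 1, by omega⟩ : Fin (L + 1)) = Fin.succ ⟨k, hk⟩ := rfl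
    simp [entry, hk, this, -Fin.succ_mk]
  · simp [entry, hk]

theorem entry_of_le {L k : ℕ} (s : Fin L → Bool) (hk : L ≤ k) : entry s k = false := by
  simp [entry, Nat.not_lt.mpr hk]

theorem countUpto_zero {L : ℕ} (s : Fin L → Bool) (b : Bool) : countUpto s 0 b = 0 := by
  simp [countUpto]

theorem countUpto_cons_succ {L : ℕ} (b c : Bool) (s : Fin L → Bool) (k : ℕ) :
    countUpto (Fin.cons b s : Fin (L + 1) → Bool) (k + 1) c =
      (if b = c then 1 else 0) + countUpto s k c := by
  simp only [countUpto, Finset.card_filter, Fin.sum_univ_succ]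
  simp

/-- The steps `s` keep a path at height `h` nonnegative and end at height `e`. -/
def HeightCond {L : ℕ} (h e : ℤ) (s : Fin L → Bool) : Prop :=
  (∀ k ≤ L, 0 ≤ h + 2 * (countUpto s k true : ℤ) - k) ∧ h + 2 * (countUpto s L true : ℤ) - L = e

/-- Appending the steps `s` to a path ending with `r` up steps creates no four consecutive
up steps. -/
def RunCond {L : ℕ} (r : ℕ) (s : Fin L → Bool) : Prop :=
  (∀ i, ¬(entry s i = true ∧ entry s (i + 1) = true ∧
    entry s (i + 2) = true ∧ entry s (i + 3) = true)) ∧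
  ¬∀ j, j + r < 4 → entry s j = true

/-- Appending the steps `s` to a path ending with `r` up steps gives a path that is empty or
ends with a down step. -/
def EndCond {L : ℕ} (r : ℕ) (s : Fin L → Bool) : Prop :=
  (L = 0 → r = 0) ∧ entry s (L - 1) = false

theorem heightCond_cons {L : ℕ} {h e : ℤ} (hh : 0 ≤ h) (b : Bool) (s : Fin L → Bool) :
    HeightCond h e (Fin.cons b s : Fin (L + 1) → Bool) ↔
      0 ≤ h + (if b then 1 else -1) ∧ HeightCond (h + if b then 1 else -1) e s := by
  have shift : ∀ k : ℕ, h + 2 * (countUpto (Fin.cons b s : Fin (L + 1) → Bool) (k + 1) true : ℤ)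
      - (k + 1 : ℕ) = (h + if b then 1 else -1) + 2 * (countUpto s k true : ℤ) - k := by
    intro k
    rw [countUpto_cons_succ]
    cases b <;> simp <;> ring
  constructor
  · rintro ⟨h1, h2⟩
    have h3 : ∀ k ≤ L, 0 ≤ (h + if b then 1 else -1) + 2 * (countUpto s k true : ℤ) - k :=
      fun k hk => shift k ▸ h1 (k + 1) (by omega)
    exact ⟨by simpa [countUpto_zero] using h3 0 (by omega), h3, shift L ▸ h2⟩
  · rintro ⟨-, h1, h2⟩
    refine ⟨fun k hk => ?_, (shift L).trans h2⟩
    cases k with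
    | zero => simpa [countUpto_zero] using hh
    | succ k => exact shift k ▸ h1 k (by omega)

theorem runCond_cons_true {L : ℕ} (r : ℕ) (s : Fin L → Bool) :
    RunCond r (Fin.cons true s : Fin (L + 1) → Bool) ↔ r < 3 ∧ RunCond (r + 1) s := by
  constructor
  · rintro ⟨h1, h2⟩
    have h3 : ¬∀ j, j + (r + 1) < 4 → entry s j = true := by
      refine fun H => h2 fun j hj => ?_
      cases j with
      | zero => exact entry_cons_zero _ _
      | succ j => rw [entry_cons_succ]; exact H j (by omega)
    refine ⟨?_, fun i => by simpa [entry_cons_succ, add_right_comm] using h1 (i + 1), h3⟩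
    by_contra hr
    exact h3 fun j hj => by omega
  · rintro ⟨hr, h1, h2⟩
    have h3 : ¬∀ j, j + r < 4 → entry (Fin.cons true s : Fin (L + 1) → Bool) j = true := by
      refine fun H => h2 fun j hj => ?_
      rw [← entry_cons_succ true s j]
      exact H _ (by omega)
    refine ⟨fun i => ?_, h3⟩
    cases i with
    | zero =>
      rintro ⟨a, b, c, d⟩
      refine h3 fun j hj => ?_
      have : j < 4 := by omega
      interval_cases j <;> assumption
    | succ i =>
      have := h1 i
      rwa [← entry_cons_succ true s i, ← entry_cons_succ true s (i + 1),
        ← entry_cons_succ true s (i + 2), ← entry_cons_succ true s (i + 3)] at this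

theorem runCond_zero_iff {L : ℕ} (s : Fin L → Bool) :
    RunCond 0 s ↔ ∀ i, ¬(entry s i = true ∧ entry s (i + 1) = true ∧
      entry s (i + 2) = true ∧ entry s (i + 3) = true) :=
  ⟨fun H => H.1, fun H => ⟨H, fun h => H 0 ⟨h 0 (by omega), h 1 (by omega), h 2 (by omega),
    h 3 (by omega)⟩⟩⟩

theorem runCond_cons_false {L r : ℕ} (hr : r ≤ 3) (s : Fin L → Bool) :
    RunCond r (Fin.cons false s : Fin (L + 1) → Bool) ↔ RunCond 0 s := by
  rw [runCond_zero_iff]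
  constructor
  · rintro ⟨h1, -⟩ i
    have := h1 (i + 1)
    rwa [show i + 1 + 2 = i + 2 + 1 by rfl, show i + 1 + 3 = i + 3 + 1 by rfl, entry_cons_succ,
      entry_cons_succ, entry_cons_succ, entry_cons_succ] at this
  · refine fun h1 => ⟨fun i => ?_, fun H => ?_⟩
    · cases i with
      | zero => simp [entry_cons_zero]
      | succ i =>
        have := h1 i
        rwa [← entry_cons_succ false s i, ← entry_cons_succ false s (i + 1),
          ← entry_cons_succ false s (i + 2), ← entry_cons_succ false s (i + 3)] at this
    · simpa [entry_cons_zero] using H 0 (by omega)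

theorem endCond_cons {L : ℕ} (r : ℕ) (b : Bool) (s : Fin L → Bool) :
    EndCond r (Fin.cons b s : Fin (L + 1) → Bool) ↔ EndCond (if b then r + 1 else 0) s := by
  cases L with
  | zero => cases b <;> simp [EndCond, entry_cons_zero, entry_of_le]
  | succ L => simp [EndCond, entry_cons_succ]

open Classical in
theorem card_filter_eq_continuationCount {L r : ℕ} {h e : ℤ} (hh : 0 ≤ h) (hr : r ≤ 3) :
    (Finset.univ.filter fun s : Fin L → Bool =>
      HeightCond h e s ∧ RunCond r s ∧ EndCond r s).card = continuationCount L h r e := by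
  induction L generalizing h r with
  | zero =>
    have : ∀ s : Fin 0 → Bool, (HeightCond h e s ∧ RunCond r s ∧ EndCond r s) ↔
        (h = e ∧ r = 0) := by
      intro s
      have hrun : RunCond r s :=
        ⟨fun i => by simp [entry_of_le], fun H => by simpa [entry_of_le] using H 0 (by omega)⟩
      simp only [HeightCond, EndCond, hrun, countUpto_zero]
      simp [countUpto_zero, hh, entry_of_le]
    simp only [this, continuationCount]
    split_ifs with hc <;> simp [hc]
  | succ L ih =>
    rw [Finset.card_filter, Fin.sum_pi_succ_eq_sum_cons, Fintype.sum_bool, ← Finset.card_filter,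
      ← Finset.card_filter, continuationCount]
    simp only [heightCond_cons hh, runCond_cons_true, runCond_cons_false hr, endCond_cons,
      if_true, Bool.false_eq_true, if_false]
    congr 1
    · split_ifs with h3
      · rw [← ih (by omega) (by omega)]
        simp [h3, (by omega : 0 ≤ h + 1)]
      · simp [h3]
    · split_ifs with h1
      · rw [← ih (by omega) (by omega)]
        simp [← sub_eq_add_neg, h1]
      · simp [h1]

theorem gdpCount_eq_continuationCount (L : ℕ) (e : ℤ) :
    gdpCount L e = continuationCount L 0 0 e := by
  classical
  rw [← card_filter_eq_continuationCount le_rfl (by omega), gdpCount]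
  congr 1
  ext s
  simp only [Finset.mem_filter, Finset.mem_univ, true_and, HeightCond, runCond_zero_iff, EndCond,
    zero_add, implies_true, and_assoc]
  refine and_congr ⟨fun H k hk => H ⟨k, by omega⟩, fun H k => H k (by omega)⟩
    (and_congr Iff.rfl (and_congr ⟨fun H i => ?_, fun H i => H i⟩ Iff.rfl))
  by_cases hi : i < L
  · exact H ⟨i, hi⟩
  · simp [entry_of_le s (not_lt.mp hi)]

theorem card_filter_eq_walkCount {m : ℕ} {h e : ℤ} (hh : 0 ≤ h) :
    (Finset.univ.filter fun s : Fin m → (({-1, 0, 1, 2} : Finset ℤ) : Type) =>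
      (∀ k, k ≤ m →
        0 ≤ h + ∑ i ∈ Finset.univ.filter (fun i : Fin m => i.val < k), (s i : ℤ)) ∧
      h + (∑ i, (s i : ℤ)) = e).card = walkCount m h e := by
  induction m generalizing h with
  | zero =>
    simp only [walkCount, Finset.univ_eq_empty, Finset.filter_empty, Finset.sum_empty, add_zero, hh]
    split_ifs with hc <;> simp [hc]
  | succ m ih =>
    have step : ∀ (a : (({-1, 0, 1, 2} : Finset ℤ) : Type))
        (s : Fin m → (({-1, 0, 1, 2} : Finset ℤ) : Type)),
        ((∀ k, k ≤ m + 1 → 0 ≤ h + ∑ i ∈ Finset.univ.filter (fun i : Fin (m + 1) => i.val < k),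
          ((Fin.cons a s : Fin (m + 1) → (({-1, 0, 1, 2} : Finset ℤ) : Type)) i : ℤ)) ∧
        h + (∑ i, ((Fin.cons a s : Fin (m + 1) → (({-1, 0, 1, 2} : Finset ℤ) : Type)) i : ℤ)) = e)
        ↔ 0 ≤ h + a ∧ ((∀ k, k ≤ m →
          0 ≤ h + a + ∑ i ∈ Finset.univ.filter (fun i : Fin m => i.val < k), (s i : ℤ)) ∧
          h + a + (∑ i, (s i : ℤ)) = e) := by
      intro a s
      simp only [Finset.sum_filter, Fin.sum_univ_succ, Fin.cons_zero, Fin.cons_succ, Fin.val_zero,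
        Fin.val_succ, ← add_assoc]
      constructor
      · rintro ⟨h1, h2⟩
        exact ⟨by simpa using h1 1 (by omega), fun k hk => by simpa using h1 (k + 1) (by omega), h2⟩
      · rintro ⟨-, h1, h2⟩
        refine ⟨fun k hk => ?_, h2⟩
        cases k with
        | zero => simpa using hh
        | succ k => simpa using h1 k (by omega)
    rw [Finset.card_filter, Fin.sum_pi_succ_eq_sum_cons, walkCount,
      ← Finset.sum_coe_sort ({-1, 0, 1, 2} : Finset ℤ)]
    refine Finset.sum_congr rfl fun a _ => ?_
    rw [← Finset.card_filter]
    simp only [step]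
    split_ifs with ha
    · rw [← ih ha]
      simp [ha]
    · simp [ha]


/-- The number of generalized Dyck paths from `(0,0)` to `(2m+n, n)` with no four
consecutive up steps that end with a down step equals the number of sequences
`(s₁, …, s_m) ∈ {-1,0,1,2}^m` with all partial sums nonnegative and total sum `n`. -/
theorem stmt_9 (m n : ℕ) :
    gdpCount (2 * m + n) (n : ℤ) =
      (Finset.univ.filter fun s : Fin m → (({-1, 0, 1, 2} : Finset ℤ) : Type) =>
        (∀ k, k ≤ m →
          0 ≤ ∑ i ∈ Finset.univ.filter (fun i : Fin m => i.val < k), (s i : ℤ)) ∧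
        (∑ i, (s i : ℤ)) = (n : ℤ)).card := by
  rw [gdpCount_eq_continuationCount,
    continuationCount_eq_walkCount (m := m) le_rfl (by push_cast; ring),
    ← card_filter_eq_walkCount le_rfl]
  simp only [zero_add]
end

section
/- Let T ⊆ ℤ be a finite set with −1 ∈ T and T∖{−1} ⊆ ℕ, let K be the largest element of T and assume K ≥ 1, let R be a commutative ring and c : T → R with c(−1) = 1 and c(K) = 1. For h, m ∈ ℕ and n ∈ ℤ let P_h(m,n) be the sum, over all sequences (s_1,…,s_m) ∈ T^m such that every partial sum h + s_1 + ⋯ + s_k (0 ≤ k ≤ m) is nonnegative and h + s_1 + ⋯ + s_m = n, of the product c(s_1)⋯c(s_m). Let f = ∑_{m≥0} P_0(m,0)·x^m ∈ R[[x]]. Then for every h ∈ ℕ, ∑_{m≥0} P_h(m,0)·x^m = x^h · f^{h+1} in R[[x]]. -/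
/-- The total weight of weighted paths with `m` steps, step heights drawn from the step set
`T`, starting at height `h`, ending at height `n`, never going below height `0`; each step of
height `i` has weight `c i`, and the weight of a path is the product of its step weights. -/
def pathWeight {R : Type*} [CommRing R] (T : Finset ℤ) (c : ℤ → R) (h : ℕ) (m : ℕ)
    (n : ℤ) : R :=
  ∑ s ∈ (Finset.univ.filter fun s : Fin m → T =>
      (∀ k, k ≤ m →
        0 ≤ (h : ℤ) + ∑ i ∈ Finset.univ.filter (fun i : Fin m => i.val < k), (s i : ℤ)) ∧
      (h : ℤ) + ∑ i, (s i : ℤ) = n),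
    ∏ i, c (s i)

theorem pathWeight_zero {R : Type*} [CommRing R] (T : Finset ℤ) (c : ℤ → R) (h : ℕ) (n : ℤ) :
    pathWeight T c h 0 n = if (h : ℤ) = n then 1 else 0 := by
  rw [pathWeight, Finset.sum_filter]
  simp

/-- Decomposition of a path according to its first step. -/
theorem pathWeight_succ {R : Type*} [CommRing R] (T : Finset ℤ) (c : ℤ → R) (h m : ℕ) (n : ℤ) :
    pathWeight T c h (m + 1) n =
      ∑ t ∈ T, if 0 ≤ (h : ℤ) + t then c t * pathWeight T c ((h : ℤ) + t).toNat m n else 0 := by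
  rw [← Finset.sum_coe_sort T, pathWeight, Finset.sum_filter,
    ← (Fin.consEquiv fun _ : Fin (m + 1) => T).sum_comp, Fintype.sum_prod_type]
  refine Finset.sum_congr rfl fun t _ => ?_
  have key (s : Fin m → T) (k : ℕ) :
      ∑ i ∈ Finset.univ.filter (fun i : Fin (m + 1) => i.val < k + 1),
        ((Fin.cons t s : Fin (m + 1) → T) i : ℤ) =
      t + ∑ i ∈ Finset.univ.filter (fun i : Fin m => i.val < k), (s i : ℤ) := by
    simp [Finset.sum_filter, Fin.sum_univ_succ]
  split_ifs with ht
  · rw [pathWeight, Finset.sum_filter, Finset.mul_sum]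
    refine Finset.sum_congr rfl fun s _ => ?_
    simp only [Fin.consEquiv_apply, Fin.sum_univ_succ, Fin.prod_univ_succ, Fin.cons_zero,
      Fin.cons_succ, mul_ite, mul_zero, Int.toNat_of_nonneg ht, add_assoc]
    refine if_congr (and_congr_left fun _ => ⟨fun H k hk => ?_, fun H k hk => ?_⟩) rfl rfl
    · simpa only [key] using H (k + 1) (by omega)
    · cases k with
      | zero => simp
      | succ k => simpa only [key] using H k (by omega)
  · refine Finset.sum_eq_zero fun s _ => if_neg fun H => ht ?_
    have := H.1 1 (by omega)
    simp only [Fin.consEquiv_apply] at this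
    rw [key s 0] at this
    simpa using this

section GeneratingFunction

open PowerSeries

variable {R : Type*} [CommRing R] (T : Finset ℤ) (c : ℤ → R)

theorem mk_pathWeight_zero (hT : (-1 : ℤ) ∈ T) (hTnn : ∀ i ∈ T, i ≠ -1 → 0 ≤ i) :
    PowerSeries.mk (fun m => pathWeight T c 0 m 0) =
      1 + X * ∑ t ∈ T.erase (-1),
        C (c t) * PowerSeries.mk (fun m => pathWeight T c t.toNat m 0) := by
  ext m
  cases m with
  | zero => simp [pathWeight_zero]
  | succ m =>
    rw [coeff_mk, pathWeight_succ, ← Finset.add_sum_erase _ _ hT]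
    simp only [map_add, coeff_succ_X_mul, map_sum, coeff_C_mul, coeff_mk, coeff_one]
    simp only [Nat.cast_zero, zero_add, Nat.add_eq_zero_iff, one_ne_zero, and_false, if_false]
    rw [if_neg (by norm_num), zero_add]
    refine Finset.sum_congr rfl fun t ht => if_pos ?_
    exact hTnn t (Finset.mem_of_mem_erase ht) (Finset.ne_of_mem_erase ht)

theorem mk_pathWeight_succ (hT : (-1 : ℤ) ∈ T) (hTnn : ∀ i ∈ T, i ≠ -1 → 0 ≤ i)
    (hcneg : c (-1) = 1) (h : ℕ) :
    PowerSeries.mk (fun m => pathWeight T c (h + 1) m 0) =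
      X * (PowerSeries.mk (fun m => pathWeight T c h m 0) + ∑ t ∈ T.erase (-1),
        C (c t) * PowerSeries.mk (fun m => pathWeight T c (h + 1 + t.toNat) m 0)) := by
  ext m
  cases m with
  | zero =>
    simp [pathWeight_zero]
    omega
  | succ m =>
    rw [coeff_mk, pathWeight_succ, ← Finset.add_sum_erase _ _ hT]
    simp only [map_add, coeff_succ_X_mul, map_sum, coeff_C_mul, coeff_mk]
    congr 1
    · rw [if_pos (by omega), hcneg, one_mul]
      congr 1
      omega
    · refine Finset.sum_congr rfl fun t ht => ?_
      have := hTnn t (Finset.mem_of_mem_erase ht) (Finset.ne_of_mem_erase ht)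
      rw [if_pos (by omega)]
      congr 2
      omega

end GeneratingFunction

/-- If `F 0 = 1 + X ∑ aₜ F (d t)` and `F (h + 1) = X (F h + ∑ aₜ F (h + 1 + d t))`, then
`F h = X ^ h * F 0 ^ (h + 1)`. -/
theorem PowerSeries.eq_X_pow_mul_pow_of_rec {R ι : Type*} [CommRing R] (S : Finset ι)
    (a : ι → PowerSeries R) (d : ι → ℕ) (F : ℕ → PowerSeries R)
    (h0 : F 0 = 1 + X * ∑ t ∈ S, a t * F (d t))
    (hs : ∀ h, F (h + 1) = X * (F h + ∑ t ∈ S, a t * F (h + 1 + d t))) (h : ℕ) :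
    F h = X ^ h * F 0 ^ (h + 1) := by
  have main (N : ℕ) : ∀ h, X ^ N ∣ F h - X ^ h * F 0 ^ (h + 1) := by
    induction N with
    | zero => simp
    | succ N ih =>
      intro h
      cases h with
      | zero => simp
      | succ h =>
        have hG : ∑ t ∈ S, a t * (X ^ (h + 1 + d t) * F 0 ^ (h + 1 + d t + 1)) =
            X ^ (h + 1) * F 0 ^ (h + 1) * ∑ t ∈ S, a t * (X ^ d t * F 0 ^ (d t + 1)) := by
          rw [Finset.mul_sum]
          exact Finset.sum_congr rfl fun t _ => by ring
        have e : F (h + 1) - X ^ (h + 1) * F 0 ^ (h + 1 + 1) =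
            X * ((F h - X ^ h * F 0 ^ (h + 1)) +
              ∑ t ∈ S, a t * (F (h + 1 + d t) - X ^ (h + 1 + d t) * F 0 ^ (h + 1 + d t + 1)) -
              X ^ (h + 1) * F 0 ^ (h + 1) *
                ∑ t ∈ S, a t * (F (d t) - X ^ d t * F 0 ^ (d t + 1))) := by
          simp only [mul_sub, Finset.sum_sub_distrib]
          rw [hG, hs h]
          linear_combination (-(X ^ (h + 1) * F 0 ^ (h + 1))) * h0
        rw [e, pow_succ']
        exact mul_dvd_mul_left _ (dvd_sub (dvd_add (ih h)
          (Finset.dvd_sum fun t _ => (ih _).mul_left _))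
          ((Finset.dvd_sum fun t _ => (ih _).mul_left _).mul_left _))
  rw [← sub_eq_zero]
  ext m
  exact X_pow_dvd_iff.mp (main (m + 1) h) m m.lt_succ_self

open PowerSeries in
/-- With `f = ∑ₘ P₀(m,0) xᵐ`, for every starting height `h` one has
`∑ₘ P_h(m,0) xᵐ = xʰ f^{h+1}`. -/
theorem stmt_15 {R : Type*} [CommRing R] (T : Finset ℤ)
    (hT : (-1 : ℤ) ∈ T) (hTnn : ∀ i ∈ T, i ≠ -1 → 0 ≤ i)
    (K : ℕ) (hKmem : (K : ℤ) ∈ T) (hKmax : ∀ i ∈ T, i ≤ (K : ℤ)) (hK1 : 1 ≤ K)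
    (c : ℤ → R) (hcneg : c (-1) = 1) (hcK : c (K : ℤ) = 1) (h : ℕ) :
    PowerSeries.mk (fun m => pathWeight T c h m 0) =
      (X : PowerSeries R) ^ h * PowerSeries.mk (fun m => pathWeight T c 0 m 0) ^ (h + 1) := by
  exact eq_X_pow_mul_pow_of_rec (T.erase (-1)) (fun t => C (c t)) Int.toNat
    (fun h => PowerSeries.mk fun m => pathWeight T c h m 0)
    (mk_pathWeight_zero T c hT hTnn) (mk_pathWeight_succ T c hT hTnn hcneg) h
end

section
/- Let R be a commutative ring, let t, g ∈ R, let T ⊆ ℤ be a finite set with −1 ∈ T and T∖{−1} ⊆ ℕ, let K be the largest element of T with K ≥ 1, and let c : T → R satisfy c(−1) = 1 and c(K) = 1. Then the following identity holds in R: (∑_{i∈T} c(i)·t^{K−i})·g − ∑_{i∈T} c(i)·(t^K·g)^{i+1} = (t^{K+1}·g − 1) · (1 − ∑_{i∈T, i≥1} c(i)·t^{K−i}·g·∑_{k=1}^{i} (t^{K+1}·g)^{k−1}). -/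
/-- The contribution of a single index `n ≤ K` to the factorization identity. -/
theorem pow_sub_mul_sub_pow_eq {R : Type*} [CommRing R] (t g : R) {n K : ℕ} (h : n ≤ K) :
    t ^ (K - n) * g - (t ^ K * g) ^ (n + 1) =
      -((t ^ (K + 1) * g - 1) *
        (t ^ (K - n) * g * ∑ k ∈ Finset.range n, (t ^ (K + 1) * g) ^ k)) := by
  obtain ⟨m, rfl⟩ := Nat.exists_eq_add_of_le h
  have hgeom := mul_geom_sum (t ^ (n + m + 1) * g) n
  have hpow : t ^ m * g * (t ^ (n + m + 1) * g) ^ n = (t ^ (n + m) * g) ^ (n + 1) := by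
    ring
  rw [Nat.add_sub_cancel_left]
  linear_combination (t ^ m * g) * hgeom + hpow


/-- The key factorization identity: in any commutative ring,
`(∑_{i∈T} cᵢ t^{K-i}) g - ∑_{i∈T} cᵢ (t^K g)^{i+1}
  = (t^{K+1} g - 1)(1 - ∑_{i∈T, i≥1} cᵢ t^{K-i} g ∑_{k=1}^{i} (t^{K+1} g)^{k-1})`. -/
theorem stmt_16 {R : Type*} [CommRing R] (t g : R) (T : Finset ℤ)
    (hT : (-1 : ℤ) ∈ T) (hTnn : ∀ i ∈ T, i ≠ -1 → 0 ≤ i)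
    (K : ℕ) (hKmem : (K : ℤ) ∈ T) (hKmax : ∀ i ∈ T, i ≤ (K : ℤ)) (hK1 : 1 ≤ K)
    (c : ℤ → R) (hcneg : c (-1) = 1) (hcK : c (K : ℤ) = 1) :
    (∑ i ∈ T, c i * t ^ ((K : ℤ) - i).toNat) * g -
        ∑ i ∈ T, c i * (t ^ K * g) ^ (i + 1).toNat =
      (t ^ (K + 1) * g - 1) *
        (1 - ∑ i ∈ T.filter (fun i => 1 ≤ i), c i * t ^ ((K : ℤ) - i).toNat * g *
          ∑ k ∈ Finset.range i.toNat, (t ^ (K + 1) * g) ^ k) := by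
  have hterm : ∀ i ∈ T, c i * t ^ ((K : ℤ) - i).toNat * g - c i * (t ^ K * g) ^ (i + 1).toNat =
      (t ^ (K + 1) * g - 1) * ((if i = -1 then 1 else 0) -
        if 1 ≤ i then c i * t ^ ((K : ℤ) - i).toNat * g *
          ∑ k ∈ Finset.range i.toNat, (t ^ (K + 1) * g) ^ k else 0) := by
    intro i hi
    by_cases hneg : i = -1
    · subst hneg
      simp [hcneg]
    · obtain ⟨n, rfl⟩ := Int.eq_ofNat_of_zero_le (hTnn i hi hneg)
      have hn : n ≤ K := by exact_mod_cast hKmax _ hi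
      have hsub : ((K : ℤ) - n).toNat = K - n := by omega
      have hsucc : ((n : ℤ) + 1).toNat = n + 1 := by omega
      have key := pow_sub_mul_sub_pow_eq t g hn
      rw [if_neg hneg, hsub, hsucc, Int.toNat_natCast]
      split_ifs with h1
      · linear_combination c n * key
      · obtain rfl : n = 0 := by omega
        simp [mul_assoc]
  rw [Finset.sum_mul, ← Finset.sum_sub_distrib, Finset.sum_congr rfl hterm, ← Finset.mul_sum,
    Finset.sum_sub_distrib, Finset.sum_ite_eq' T, if_pos hT, Finset.sum_filter]
end
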